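/- Let α ∈ (0,1) be irrational with bounded partial quotients (equivalently, α is badly approximable: there is c > 0 with |qα − p| ≥ c/q for all integers p and all integers q ≥ 1). Let T be the rotation of angle α on [0,1), N ≥ 2 an integer, and T_f the Veech 1969 type extension of T with marked points 0 < ζ₁ < ... < ζ_q < 1 and integers a₁, ..., a_{q+1}. Set ζ₀ = 0, and let the jumps of f be e_i = a_{i+1} − a_i for 1 ≤ i ≤ q and e₀ = a₁ − a_{q+1}. Assume that at least one difference ζ_i − ζ_j (0 ≤ j < i ≤ q) does not belong to ℤ + αℤ, and that for every nonzero d ∈ ℤ/Nℤ no nonempty proper subset of the family {d·e₀, d·e₁, ..., d·e_q} has sum equal to 0 in ℤ/Nℤ. Then T_f is minimal and uniquely ergodic. -/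

import Mathlib

open Set

noncomputable section

/-- The rotation of angle `α` on `[0,1)`: `x ↦ x + α mod 1`. -/
def rot (α : ℝ) (x : ℝ) : ℝ := Int.fract (x + α)

/-- The skew product `T_f(x,s) = (Tx, s + f(x))` on `[0,1) × ℤ/Nℤ`. -/
def skew {N : ℕ} (T : ℝ → ℝ) (f : ℝ → ZMod N) : ℝ × ZMod N → ℝ × ZMod N :=
  fun p => (T p.1, p.2 + f p.1)

/-- Minimality of the skew product on `[0,1) × ℤ/Nℤ`, where `[0,1)` carries the topology of
the circle `ℝ/ℤ` (distances being measured in `AddCircle 1`) and `ℤ/Nℤ` is discrete: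
every forward orbit is dense. -/
def MinimalExt {N : ℕ} (T : ℝ → ℝ) (f : ℝ → ZMod N) : Prop :=
  ∀ x ∈ Ico (0:ℝ) 1, ∀ s : ZMod N, ∀ y ∈ Ico (0:ℝ) 1, ∀ u : ZMod N, ∀ ε > 0, ∃ n : ℕ,
    dist (((skew T f)^[n] (x, s)).1 : AddCircle (1:ℝ)) (y : AddCircle (1:ℝ)) < ε ∧
    ((skew T f)^[n] (x, s)).2 = u


/-- The index `i` such that `x ∈ [ζ_{i-1}, ζ i)`, for marked points `ζ₁ < ... < ζ_q`
(with the conventions `ζ₀ = 0`, `ζ_{q+1} = 1`): the number of marked points `≤ x`. -/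
def zIdx (q : ℕ) (ζ : Fin q → ℝ) (x : ℝ) : Fin (q + 1) :=
  ⟨(Finset.univ.filter fun i => ζ i ≤ x).card,
    Nat.lt_succ_of_le (le_trans (Finset.card_filter_le _ _) (by simp))⟩

/-- The step function determined by marked points `ζ₁ < ... < ζ_q` and integers
`a₁, ..., a_{q+1}`: it takes the value `aᵢ` on `[ζ_{i-1}, ζ_i)` (in `ℤ/Nℤ`). -/
def stepFun (N q : ℕ) (ζ : Fin q → ℝ) (a : Fin (q + 1) → ℤ) (x : ℝ) : ZMod N :=
  ((a (zIdx q ζ x) : ℤ) : ZMod N)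

/-- The skew product `T_f` as a self-map of `[0,1) × ℤ/Nℤ`, for `T` the rotation of angle
`α` on `[0,1)`. -/
def rotExt (N : ℕ) (α : ℝ) (f : ℝ → ZMod N) :
    (↥(Ico (0:ℝ) 1) × ZMod N) → (↥(Ico (0:ℝ) 1) × ZMod N) :=
  fun p => (⟨Int.fract ((p.1 : ℝ) + α), Set.mem_Ico.mpr ⟨Int.fract_nonneg _, Int.fract_lt_one _⟩⟩,
    p.2 + f p.1)

/-- A self-map of a measurable space is uniquely ergodic if it admits a unique invariant
(Borel) probability measure. -/
def UniquelyErgodic {X : Type*} [MeasurableSpace X] (G : X → X) : Prop :=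
  ∃! μ : MeasureTheory.Measure X,
    MeasureTheory.IsProbabilityMeasure μ ∧ MeasureTheory.MeasurePreserving G μ μ

/-- The arc `[0, t)` of the circle. -/
def arc (t : ℝ) : Set UnitAddCircle := (fun x : ℝ => (x : UnitAddCircle)) '' Ico 0 t

lemma norm_coe_unitAddCircle_le_abs (x : ℝ) : ‖(x : UnitAddCircle)‖ ≤ |x| :=
  QuotientAddGroup.norm_mk_le_norm

lemma norm_sub_lt_of_mem_arc {t : ℝ} {x y : UnitAddCircle} (hx : x ∈ arc t) (hy : y ∈ arc t) :
    ‖x - y‖ < t := by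
  obtain ⟨a, ha, rfl⟩ := hx
  obtain ⟨b, hb, rfl⟩ := hy
  refine (norm_coe_unitAddCircle_le_abs (a - b)).trans_lt ?_
  rw [abs_lt]
  constructor <;> linarith [ha.1, ha.2, hb.1, hb.2]

lemma measurableSet_arc {t : ℝ} (ht : t ≤ 1) : MeasurableSet (arc t) := by
  refine measurableSet_Ico.image_of_continuousOn_injOn
    (AddCircle.continuous_mk' (1 : ℝ)).continuousOn ?_
  intro a ha b hb hab
  exact (AddCircle.coe_eq_coe_iff_of_mem_Ico (a := (0 : ℝ)) (p := (1 : ℝ))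
    ⟨ha.1, by linarith [ha.2]⟩ ⟨hb.1, by linarith [hb.2]⟩).1 hab

lemma ofReal_le_volume_arc {t : ℝ} (ht : t ≤ 1) :
    ENNReal.ofReal t ≤ MeasureTheory.volume (arc t) := by
  rw [AddCircle.add_projection_respects_measure 1 0 (measurableSet_arc ht)]
  have hsub : Ioo 0 t ⊆ QuotientAddGroup.mk ⁻¹' arc t ∩ Ioc (0 : ℝ) (0 + 1) := fun x hx =>
    ⟨⟨x, ⟨hx.1.le, hx.2⟩, rfl⟩, ⟨hx.1, by linarith [hx.2]⟩⟩
  simpa using MeasureTheory.measure_mono (μ := MeasureTheory.volume) hsub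

lemma nsmul_sub_nsmul_norm_ge {α : UnitAddCircle} {c : ℝ} (hc : 0 < c)
    (hbad : ∀ n : ℕ, 1 ≤ n → c / n ≤ ‖n • α‖) {n k l : ℕ} (hk : k < n) (hl : l < n)
    (hkl : k ≠ l) : c / n ≤ ‖k • α - l • α‖ := by
  wlog h : l < k generalizing k l
  · rw [norm_sub_rev]
    exact this hl hk hkl.symm (by omega)
  rw [← sub_nsmul α h.le |>.trans (sub_eq_add_neg _ _).symm]
  refine le_trans ?_ (hbad (k - l) (by omega))
  have : (0 : ℝ) < ((k - l : ℕ) : ℝ) := by exact_mod_cast (by omega : 0 < k - l)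
  have : ((k - l : ℕ) : ℝ) ≤ n := by exact_mod_cast (by omega : k - l ≤ n)
  gcongr

open Classical in
/-- The Birkhoff sums of a step function over a short interval jump according to the set of
discontinuities whose backward orbit of length `n` meets that interval. -/
lemma birkhoff_jump {ι : Type*} [Fintype ι] {G : Type*} [AddCommGroup G] {α : UnitAddCircle}
    {c : ℝ} (hc : 0 < c) (hbad : ∀ n : ℕ, 1 ≤ n → c / n ≤ ‖n • α‖)
    {F : UnitAddCircle → G} {z : ι → UnitAddCircle} {e : ι → G}
    (hF : ∀ x, ∀ t ∈ Ioo (0 : ℝ) 1, F (x + t) - F x =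
      ∑ i, if x + t - z i ∈ arc t then e i else 0)
    {n : ℕ} {t : ℝ} (ht : t ∈ Ioo (0 : ℝ) 1) (htn : t ≤ c / n) (x : UnitAddCircle) :
    ∑ k ∈ Finset.range n, F (x + t + k • α) - ∑ k ∈ Finset.range n, F (x + k • α) =
      ∑ i with (∃ k < n, x + t + k • α - z i ∈ arc t), e i := by
  rw [← Finset.sum_sub_distrib, Finset.sum_filter]
  have h1 : ∀ k ∈ Finset.range n, F (x + t + k • α) - F (x + k • α) =
      ∑ i, if x + t + k • α - z i ∈ arc t then e i else 0 := by
    intro k _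
    rw [add_right_comm, hF _ t ht]
  rw [Finset.sum_congr rfl h1, Finset.sum_comm]
  refine Finset.sum_congr rfl fun i _ => ?_
  split_ifs with h
  · obtain ⟨k, hk, hkt⟩ := h
    rw [Finset.sum_eq_single k, if_pos hkt]
    · intro l hl hlk
      refine if_neg fun hlt => ?_
      have h2 := norm_sub_lt_of_mem_arc hkt hlt
      rw [sub_sub_sub_cancel_right, add_sub_add_left_eq_sub] at h2
      have := nsmul_sub_nsmul_norm_ge hc hbad hk (Finset.mem_range.1 hl) hlk.symm
      linarith
    · intro hk'
      exact absurd (Finset.mem_range.2 hk) hk'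
  · refine Finset.sum_eq_zero fun k hk => if_neg fun hkt => h ⟨k, Finset.mem_range.1 hk, hkt⟩

lemma le_volume_exists_mem_arc {α : UnitAddCircle}
    {c : ℝ} (hc : 0 < c) (hbad : ∀ n : ℕ, 1 ≤ n → c / n ≤ ‖n • α‖)
    {n : ℕ} {t : ℝ} (ht1 : t ≤ 1) (htn : t ≤ c / n) (w : UnitAddCircle) :
    n * ENNReal.ofReal t ≤
      MeasureTheory.volume {x : UnitAddCircle | ∃ k < n, x + t + k • α - w ∈ arc t} := by
  have hset : {x : UnitAddCircle | ∃ k < n, x + t + k • α - w ∈ arc t} =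
      ⋃ k ∈ Finset.range n, (fun x => x + (t + k • α - w)) ⁻¹' arc t := by
    ext x
    simp [add_assoc, add_sub_assoc]
  rw [hset, MeasureTheory.measure_biUnion_finset]
  · simp only [MeasureTheory.measure_preimage_add_right, Finset.sum_const, Finset.card_range,
      nsmul_eq_mul]
    gcongr
    exact ofReal_le_volume_arc ht1
  · intro k hk l hl hkl
    rw [Function.onFun, Set.disjoint_left]
    intro x hxk hxl
    have h2 := norm_sub_lt_of_mem_arc (t := t) hxk hxl
    rw [add_sub_add_left_eq_sub, sub_sub_sub_cancel_right, add_sub_add_left_eq_sub] at h2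
    have := nsmul_sub_nsmul_norm_ge hc hbad (Finset.mem_range.1 hk) (Finset.mem_range.1 hl) hkl
    linarith
  · intro k _
    exact (measurable_add_const _) (measurableSet_arc ht1)

/-- A point that is uniformly well approximated by the orbit of a badly approximable rotation
lies on that orbit. -/
lemma mem_zmultiples_of_uniform_approx {α w : UnitAddCircle}
    {c δ : ℝ} (hbad : ∀ n : ℕ, 1 ≤ n → c / n ≤ ‖n • α‖) (hδ0 : 0 < δ) (hδ : 4 * δ < c)
    (h : ∀ᶠ n : ℕ in Filter.atTop, ∃ k : ℤ, |k| < n ∧ ‖w - k • α‖ < δ / n) :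
    w ∈ AddSubgroup.zmultiples α := by
  obtain ⟨n₀, hn₀⟩ := Filter.eventually_atTop.1 h
  have hbadZ : ∀ (m : ℕ) (k : ℤ), k ≠ 0 → |k| ≤ m → c / m ≤ ‖k • α‖ := by
    intro m k hk hkm
    have h1 : ‖k • α‖ = ‖k.natAbs • α‖ := by
      rcases Int.natAbs_eq k with h | h
      · conv_lhs => rw [h, natCast_zsmul]
      · conv_lhs => rw [h, neg_smul, norm_neg, natCast_zsmul]
    rw [h1]
    rw [Int.abs_eq_natAbs] at hkm
    refine le_trans ?_ (hbad _ (by omega))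
    have : (0 : ℝ) < (k.natAbs : ℝ) := by exact_mod_cast (by omega : 0 < k.natAbs)
    have : (k.natAbs : ℝ) ≤ m := by exact_mod_cast (by omega : k.natAbs ≤ m)
    have : 0 < c := by linarith
    gcongr
  choose! k hk hkw using hn₀
  have hstep : ∀ n, max n₀ 1 ≤ n → k (n + 1) = k n := by
    intro n hn
    have hn1 : n₀ ≤ n := le_of_max_le_left hn
    have hn2 : (0 : ℝ) < n := by exact_mod_cast (le_of_max_le_right hn)
    by_contra hne
    have h1 := hkw n hn1
    have h2 := hkw (n + 1) (by omega)
    have h3 := hk n hn1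
    have h4 := hk (n + 1) (by omega)
    have h5 := hbadZ (2 * n) (k (n + 1) - k n) (sub_ne_zero.2 hne) (by
      rw [abs_lt] at h3 h4
      rw [abs_le]
      push_cast at *
      constructor <;> omega)
    have h6 : (k (n + 1) - k n) • α = (w - k n • α) - (w - k (n + 1) • α) := by
      rw [sub_smul]; abel
    rw [h6] at h5
    have h7 := norm_sub_le (w - k n • α) (w - k (n + 1) • α)
    have h8 : δ / ((n + 1 : ℕ) : ℝ) ≤ δ / n := by
      gcongr
      simp
    have h9 : c / ((2 * n : ℕ) : ℝ) < 2 * δ / n := by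
      have : 2 * δ / n = δ / n + δ / n := by ring
      linarith
    push_cast at h9
    rw [div_lt_div_iff₀ (by positivity) hn2] at h9
    nlinarith
  set m := max n₀ 1 with hm
  have hconst : ∀ n, m ≤ n → k n = k m := by
    intro n hn
    induction n, hn using Nat.le_induction with
    | base => rfl
    | succ n hn ih => rw [hstep n hn, ih]
  have hle : ∀ n : ℕ, m ≤ n → ‖w - k m • α‖ ≤ δ / n := fun n hn => by
    have := hkw n ((le_max_left _ _).trans hn)
    rw [hconst n hn] at this
    exact this.le
  have hlim : Filter.Tendsto (fun n : ℕ => δ / (n : ℝ)) Filter.atTop (nhds 0) :=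
    tendsto_const_div_atTop_nhds_zero_nat δ
  have hzero : ‖w - k m • α‖ ≤ 0 :=
    ge_of_tendsto hlim (Filter.eventually_atTop.2 ⟨m, hle⟩)
  rw [norm_le_zero_iff, sub_eq_zero] at hzero
  exact ⟨k m, hzero.symm⟩

open MeasureTheory Filter Topology

/-- The skew product over the rotation of the circle by `α`. -/
def circExt {G : Type*} [AddCommGroup G] (α : UnitAddCircle) (F : UnitAddCircle → G) :
    UnitAddCircle × G → UnitAddCircle × G :=
  fun p => (p.1 + α, p.2 + F p.1)

lemma circExt_iterate {G : Type*} [AddCommGroup G] (α : UnitAddCircle) (F : UnitAddCircle → G)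
    (n : ℕ) (x : UnitAddCircle) (s : G) :
    (circExt α F)^[n] (x, s) = (x + n • α, s + ∑ k ∈ Finset.range n, F (x + k • α)) := by
  induction n with
  | zero => simp
  | succ n ih =>
    rw [Function.iterate_succ_apply', ih, circExt, Finset.sum_range_succ, succ_nsmul, add_assoc,
      add_assoc]

lemma mem_iterate_iff_of_preimage_eq {X : Type*} {f : X → X} {E : Set X} (h : f ⁻¹' E = E)
    (n : ℕ) (x : X) : f^[n] x ∈ E ↔ x ∈ E := by
  induction n with
  | zero => rfl
  | succ n ih => rw [Function.iterate_succ_apply', ← mem_preimage, h, ih]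

lemma iff_of_forall_iff_add_unit {N : ℕ} [NeZero N] {u : ZMod N} (hu : IsUnit u)
    {P : ZMod N → Prop} (h : ∀ s, P s ↔ P (s + u)) (s s' : ZMod N) : P s ↔ P s' := by
  have key : ∀ (m : ℕ) (s : ZMod N), P s ↔ P (s + m * u) := by
    intro m s
    induction m with
    | zero => simp
    | succ m ih => rw [ih, h, add_assoc]; push_cast; rw [add_mul, one_mul]
  obtain ⟨v, hv⟩ := hu.exists_left_inv
  have := key ((s' - s) * v).val s
  rwa [ZMod.natCast_zmod_val, mul_assoc, hv, mul_one, add_sub_cancel] at this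

/-- The points whose fibre in `E` changes under translation by `t`. -/
def fiberChange {N : ℕ} (E : Set (UnitAddCircle × ZMod N)) (t : UnitAddCircle) :
    Set UnitAddCircle :=
  {x | ∃ s, ¬ ((x + t, s) ∈ E ↔ (x, s) ∈ E)}

lemma tendsto_volume_fiberChange {N : ℕ} [NeZero N] {E : Set (UnitAddCircle × ZMod N)}
    (hE : MeasurableSet E) :
    Tendsto (fun t => volume (fiberChange E t)) (𝓝 0) (𝓝 0) := by
  have hset : ∀ t, fiberChange E t = ⋃ s : ZMod N,
      symmDiff ((fun x => x + t) ⁻¹' {x | (x, s) ∈ E}) {x | (x, s) ∈ E} := by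
    intro t
    ext x
    simp only [fiberChange, mem_ofPred_eq, mem_iUnion, mem_symmDiff, mem_preimage]
    exact exists_congr fun s => by tauto
  have hlim : ∀ s : ZMod N, Tendsto (fun t : UnitAddCircle => volume
      (symmDiff ((fun x => x + t) ⁻¹' {x | (x, s) ∈ E}) {x | (x, s) ∈ E})) (𝓝 0) (𝓝 0) := by
    intro s
    have hc : Continuous fun t : UnitAddCircle => (ContinuousMap.mk (fun x : UnitAddCircle => x + t)) :=
      ContinuousMap.continuous_of_continuous_uncurry _ (by
        simp only [Function.uncurry_def, ContinuousMap.coe_mk]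
        fun_prop)
    have hms : MeasurableSet {x : UnitAddCircle | (x, s) ∈ E} := hE.preimage measurable_prodMk_right
    have := tendsto_measure_symmDiff_preimage_nhds_zero (μ := volume) (ν := volume)
      (hc.tendsto 0) (Eventually.of_forall fun t => measurePreserving_add_right volume t)
      (measurePreserving_add_right volume 0) (s := {x : UnitAddCircle | (x, s) ∈ E})
      hms.nullMeasurableSet (measure_ne_top _ _)
    simpa using this
  have hsum := tendsto_finsetSum (Finset.univ : Finset (ZMod N)) fun s _ => hlim s
  rw [Finset.sum_const_zero] at hsum
  refine tendsto_of_tendsto_of_tendsto_of_le_of_le tendsto_const_nhds hsum (fun _ => zero_le) ?_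
  intro t
  dsimp only
  rw [hset]
  refine (measure_iUnion_le _).trans ?_
  rw [tsum_fintype]

open Classical in
lemma not_ae_nontrivial_fiber {ι : Type*} [Fintype ι] {N : ℕ} [NeZero N] {α : UnitAddCircle}
    {c : ℝ} (hc : 0 < c) (hbad : ∀ n : ℕ, 1 ≤ n → c / n ≤ ‖n • α‖)
    {F : UnitAddCircle → ZMod N} {z : ι → UnitAddCircle} {e : ι → ZMod N}
    (hF : ∀ x, ∀ t ∈ Ioo (0 : ℝ) 1, F (x + t) - F x =
      ∑ i, if x + t - z i ∈ arc t then e i else 0)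
    (hunit : ∀ s : Finset ι, s.Nonempty → s ≠ Finset.univ → IsUnit (∑ i ∈ s, e i))
    (hz : ∃ i j, z i - z j ∉ AddSubgroup.zmultiples α)
    {E : Set (UnitAddCircle × ZMod N)} (hE : MeasurableSet E) (hinv : circExt α F ⁻¹' E = E) :
    ¬ ∀ᵐ x : UnitAddCircle, ∃ s s', (x, s) ∈ E ∧ (x, s') ∉ E := by
  intro hP
  obtain ⟨i, j, hij⟩ := hz
  set δ : ℝ := min c 1 / 8 with hδ
  have hδ0 : 0 < δ := by positivity
  have hδc : 8 * δ ≤ c := by rw [hδ]; linarith [min_le_left c 1]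
  have hδ1 : 8 * δ ≤ 1 := by rw [hδ]; linarith [min_le_right c 1]
  refine hij (mem_zmultiples_of_uniform_approx hbad hδ0 (by linarith) ?_)
  have ht : Tendsto (fun n : ℕ => ((δ / n : ℝ) : UnitAddCircle)) atTop (𝓝 0) :=
    ((AddCircle.continuous_mk' (1 : ℝ)).tendsto 0).comp (tendsto_const_div_atTop_nhds_zero_nat δ)
  have hκ := (tendsto_volume_fiberChange hE).comp ht
  have hκ2 := hκ.add hκ
  rw [add_zero] at hκ2
  filter_upwards [hκ2.eventually (gt_mem_nhds (ENNReal.ofReal_pos.2 hδ0)),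
    eventually_ge_atTop 1] with n hn hn1
  by_contra! hk
  have hn0 : (0 : ℝ) < n := by exact_mod_cast hn1
  have hn1' : (1 : ℝ) ≤ n := by exact_mod_cast hn1
  set t : ℝ := δ / n with htdef
  have ht0 : 0 < t := by positivity
  have htδ : t ≤ δ := div_le_self hδ0.le hn1'
  have htc : t ≤ c / n := by rw [htdef]; gcongr; linarith
  have hvol := le_volume_exists_mem_arc hc hbad (by linarith : t ≤ 1) htc (z i)
  have hnt : (n : ENNReal) * ENNReal.ofReal t = ENNReal.ofReal δ := by
    rw [← ENNReal.ofReal_natCast, ← ENNReal.ofReal_mul hn0.le, htdef, mul_div_cancel₀ _ hn0.ne']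
  rw [hnt] at hvol
  have hsub : {x : UnitAddCircle | ∃ k < n, x + t + k • α - z i ∈ arc t} ≤ᵐ[volume]
      (fiberChange E t ∪ (fun x => x + n • α) ⁻¹' fiberChange E t : Set UnitAddCircle) := by
    filter_upwards [hP] with x hx hxi
    obtain ⟨k, hkn, hxk⟩ := hxi
    by_contra hxb
    have hxb' := not_or.1 hxb
    have hx1 : ∀ s, (x + t, s) ∈ E ↔ (x, s) ∈ E := by
      simpa [fiberChange] using hxb'.1
    have hx2 : ∀ s, (x + n • α + t, s) ∈ E ↔ (x + n • α, s) ∈ E := by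
      simpa [fiberChange] using hxb'.2
    have hjump := birkhoff_jump hc hbad hF ⟨ht0, by linarith⟩ htc x
    set S : Finset ι := Finset.univ.filter fun i => ∃ k < n, x + t + k • α - z i ∈ arc t
    have hiS : i ∈ S := by
      simp only [S, Finset.mem_filter, Finset.mem_univ, true_and]
      exact ⟨k, hkn, hxk⟩
    have hjS : j ∉ S := by
      simp only [S, Finset.mem_filter, Finset.mem_univ, true_and]
      rintro ⟨l, hln, hxl⟩
      have h1 := norm_sub_lt_of_mem_arc hxk hxl
      have h2 := hk (k - l) (by rw [abs_lt]; constructor <;> omega)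
      rw [norm_sub_rev, sub_smul, natCast_zsmul, natCast_zsmul] at h2
      have h3 : x + t + k • α - z i - (x + t + l • α - z j) =
          k • α - l • α - (z i - z j) := by abel
      rw [h3] at h1
      linarith
    have hu := hunit S ⟨i, hiS⟩ fun h => hjS (h ▸ Finset.mem_univ j)
    obtain ⟨s, s', hs, hs'⟩ := hx
    refine hs' ((iff_of_forall_iff_add_unit hu (P := fun s => (x, s) ∈ E) (fun s => ?_) s s').1 hs)
    have h4 := mem_iterate_iff_of_preimage_eq hinv n (x + t, s)
    have h5 := mem_iterate_iff_of_preimage_eq hinv n (x, s + ∑ i ∈ S, e i)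
    rw [circExt_iterate] at h4 h5
    rw [← hx1, ← h4, ← h5, ← hx2, sub_eq_iff_eq_add.1 hjump, add_right_comm x, add_assoc s]
  have h6 := hvol.trans ((measure_mono_ae hsub).trans (measure_union_le _ _))
  rw [measure_preimage_add_right] at h6
  exact absurd hn (not_lt.2 h6)

/-- The uniform probability measure on `ℤ/Nℤ`. -/
def unif (N : ℕ) : Measure (ZMod N) := (N : ENNReal)⁻¹ • Measure.count

instance (N : ℕ) [NeZero N] : IsProbabilityMeasure (unif N) := by
  constructor
  rw [unif, Measure.smul_apply, Measure.count_apply_finite _ finite_univ]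
  simp [ZMod.card]
  exact ENNReal.inv_mul_cancel (by simp [NeZero.ne]) (by simp)

lemma unif_eq_zero_iff {N : ℕ} {s : Set (ZMod N)} : unif N s = 0 ↔ s = ∅ := by
  simp [unif, Measure.count_eq_zero_iff]

lemma measurePreserving_circExt {N : ℕ} [NeZero N] (α : UnitAddCircle)
    {F : UnitAddCircle → ZMod N} (hFm : Measurable F) :
    MeasurePreserving (circExt α F) (volume.prod (unif N)) (volume.prod (unif N)) := by
  refine (measurePreserving_add_right volume α).skew_product
    (g := fun x s => s + F x) ?_ ?_
  · exact measurable_snd.add (hFm.comp measurable_fst)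
  · refine Eventually.of_forall fun x => ?_
    rw [unif, Measure.map_smul, map_add_right_eq_self]

open Classical in
theorem ergodic_circExt {ι : Type*} [Fintype ι] {N : ℕ} [NeZero N] {α : UnitAddCircle}
    {c : ℝ} (hc : 0 < c) (hbad : ∀ n : ℕ, 1 ≤ n → c / n ≤ ‖n • α‖)
    {F : UnitAddCircle → ZMod N} (hFm : Measurable F) {z : ι → UnitAddCircle} {e : ι → ZMod N}
    (hF : ∀ x, ∀ t ∈ Ioo (0 : ℝ) 1, F (x + t) - F x =
      ∑ i, if x + t - z i ∈ arc t then e i else 0)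
    (hunit : ∀ s : Finset ι, s.Nonempty → s ≠ Finset.univ → IsUnit (∑ i ∈ s, e i))
    (hz : ∃ i j, z i - z j ∉ AddSubgroup.zmultiples α) (hα : addOrderOf α = 0) :
    Ergodic (circExt α F) (volume.prod (unif N)) := by
  refine ⟨measurePreserving_circExt α hFm, ⟨fun E hE hinv => ?_⟩⟩
  have hrot : Ergodic (· + α : UnitAddCircle → UnitAddCircle) := AddCircle.ergodic_add_right.2 hα
  have hmem : ∀ x s, (x + α, s + F x) ∈ E ↔ (x, s) ∈ E := fun x s => by
    conv_rhs => rw [← hinv]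
    rfl
  have hms : ∀ s, MeasurableSet {x : UnitAddCircle | (x, s) ∈ E} :=
    fun s => hE.preimage measurable_prodMk_right
  have hU : MeasurableSet {x : UnitAddCircle | ∀ s, (x, s) ∈ E} := by
    rw [ofPred_forall]
    exact MeasurableSet.iInter hms
  have hV : MeasurableSet {x : UnitAddCircle | ∃ s, (x, s) ∈ E} := by
    rw [ofPred_exists]
    exact MeasurableSet.iUnion hms
  have hUinv : (· + α) ⁻¹' {x : UnitAddCircle | ∀ s, (x, s) ∈ E} = {x | ∀ s, (x, s) ∈ E} := by
    ext x
    simp only [mem_preimage, mem_ofPred_eq]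
    rw [← (Equiv.addRight (F x)).forall_congr_right]
    exact forall_congr' fun s => hmem x s
  have hVinv : (· + α) ⁻¹' {x : UnitAddCircle | ∃ s, (x, s) ∈ E} = {x | ∃ s, (x, s) ∈ E} := by
    ext x
    simp only [mem_preimage, mem_ofPred_eq]
    rw [← (Equiv.addRight (F x)).exists_congr_right]
    exact exists_congr fun s => hmem x s
  rw [eventuallyConst_set']
  rcases eventuallyConst_set'.1 (hrot.aeconst_set hV hVinv) with hV0 | hV1
  · left
    rw [ae_eq_empty, Measure.measure_prod_null hE]
    filter_upwards [measure_eq_zero_iff_ae_notMem.1 (ae_eq_empty.1 hV0)] with x hx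
    refine unif_eq_zero_iff.2 (eq_empty_of_forall_notMem fun s hs => hx ⟨s, hs⟩)
  rcases eventuallyConst_set'.1 (hrot.aeconst_set hU hUinv) with hU0 | hU1
  · refine absurd ?_ (not_ae_nontrivial_fiber hc hbad hF hunit hz hE hinv)
    filter_upwards [measure_eq_zero_iff_ae_notMem.1 (ae_eq_empty.1 hU0),
      eventuallyEq_univ.1 hV1] with x hx hx'
    obtain ⟨s, hs⟩ := hx'
    obtain ⟨s', hs'⟩ := not_forall.1 hx
    exact ⟨s, s', hs, hs'⟩
  · right
    rw [ae_eq_univ, Measure.measure_prod_null hE.compl]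
    filter_upwards [eventuallyEq_univ.1 hU1] with x hx
    exact unif_eq_zero_iff.2 (eq_empty_of_forall_notMem fun s hs => hs (hx s))

instance : IsProbabilityMeasure (volume : Measure UnitAddCircle) :=
  ⟨UnitAddCircle.measure_univ⟩

/-- The irrational rotation of the circle is uniquely ergodic. -/
lemma eq_volume_of_measurePreserving_rotation {α : UnitAddCircle} (hα : addOrderOf α = 0)
    {ν : Measure UnitAddCircle} [IsProbabilityMeasure ν]
    (hν : MeasurePreserving (· + α) ν ν) : ν = volume := by
  have hiter : ∀ n : ℕ, MeasurePreserving (· + n • α) ν ν := by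
    intro n
    have := hν.iterate n
    rwa [add_right_iterate] at this
  have hdense : DenseRange (fun n : ℕ => n • α) :=
    denseRange_zsmul_iff_nsmul.1 (AddCircle.denseRange_zsmul_iff.2 hα)
  have hinv : ∀ θ : UnitAddCircle, ν.map (· + θ) = ν := by
    intro θ
    have : IsFiniteMeasure (ν.map (· + θ)) := by
      have := Measure.isProbabilityMeasure_map (μ := ν) (measurable_add_const θ).aemeasurable
      infer_instance
    refine ext_of_forall_integral_eq_of_IsFiniteMeasure fun g => ?_
    rw [integral_map (measurable_add_const θ).aemeasurable
      g.continuous.aestronglyMeasurable]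
    have hcont : Continuous fun θ : UnitAddCircle => ∫ x, g (x + θ) ∂ν :=
      continuous_of_dominated (bound := fun _ => ‖g‖)
        (fun θ => (by fun_prop : Continuous fun x => g (x + θ)).aestronglyMeasurable)
        (fun θ => Eventually.of_forall fun x => g.norm_coe_le_norm _)
        (integrable_const _) (Eventually.of_forall fun x => by fun_prop)
    refine congrFun (hdense.equalizer hcont (continuous_const (y := ∫ x, g x ∂ν)) ?_) θ
    ext n
    have := (hiter n).integral_comp' (f := MeasurableEquiv.addRight (n • α)) g
    simpa using this
  have : ν.IsAddLeftInvariant := ⟨fun θ => by simpa only [add_comm] using hinv θ⟩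
  have h := Measure.isAddInvariant_eq_smul_of_compactSpace ν volume
  have h1 := congrArg (fun μ : Measure UnitAddCircle => μ univ) h
  simp only [measure_univ, Measure.smul_apply] at h1
  rw [ENNReal.smul_def, smul_eq_mul, mul_one] at h1
  rw [h, ENNReal.smul_def, ← h1, one_smul]

lemma eq_prod_of_measurePreserving_circExt {N : ℕ} [NeZero N] {α : UnitAddCircle}
    (hα : addOrderOf α = 0) {F : UnitAddCircle → ZMod N}
    (herg : Ergodic (circExt α F) (volume.prod (unif N)))
    {ν : Measure (UnitAddCircle × ZMod N)} [IsProbabilityMeasure ν]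
    (hν : MeasurePreserving (circExt α F) ν ν) : ν = volume.prod (unif N) := by
  refine herg.eq_of_absolutelyContinuous hν ?_
  have : IsProbabilityMeasure (ν.map Prod.fst) :=
    Measure.isProbabilityMeasure_map measurable_fst.aemeasurable
  have hfst : ν.map Prod.fst = volume := by
    refine eq_volume_of_measurePreserving_rotation hα ⟨measurable_add_const α, ?_⟩
    rw [Measure.map_map (measurable_add_const α) measurable_fst]
    conv_rhs => rw [← hν.map_eq]
    rw [Measure.map_map measurable_fst hν.measurable]
    rfl
  refine Measure.AbsolutelyContinuous.mk fun A hA h0 => ?_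
  rw [Measure.measure_prod_null hA, ← hfst] at h0
  refine measure_eq_zero_iff_ae_notMem.2 ?_
  filter_upwards [ae_of_ae_map measurable_fst.aemeasurable h0] with p hp hpA
  exact (unif_eq_zero_iff.1 hp ▸ (show p.2 ∈ Prod.mk p.1 ⁻¹' A from hpA) : p.2 ∈ (∅ : Set (ZMod N)))

lemma uniquelyErgodic_circExt {N : ℕ} [NeZero N] {α : UnitAddCircle}
    (hα : addOrderOf α = 0) {F : UnitAddCircle → ZMod N}
    (herg : Ergodic (circExt α F) (volume.prod (unif N))) :
    UniquelyErgodic (circExt α F) := by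
  refine ⟨_, ⟨inferInstance, herg.toMeasurePreserving⟩, ?_⟩
  rintro ν ⟨hν, hν'⟩
  exact eq_prod_of_measurePreserving_circExt hα herg hν'

/-- If the skew product is ergodic and the cocycle is locally constant on the right, then every
forward orbit of the skew product is dense. -/
lemma exists_iterate_mem_of_ergodic {N : ℕ} [NeZero N] {α : UnitAddCircle}
    (hα : addOrderOf α = 0) {F : UnitAddCircle → ZMod N}
    (herg : Ergodic (circExt α F) (volume.prod (unif N)))
    (hright : ∀ x : UnitAddCircle, ∀ᶠ t : ℝ in 𝓝[>] 0, F (x + t) = F x)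
    (x : UnitAddCircle) (s : ZMod N) {B : Set UnitAddCircle} (hB : IsOpen B) (hB0 : B.Nonempty)
    (u : ZMod N) : ∃ n : ℕ, (circExt α F)^[n] (x, s) ∈ B ×ˢ {u} := by
  have hae : ∀ v : ZMod N, ∀ᵐ p ∂(volume.prod (unif N)),
      ∃ n : ℕ, (circExt α F)^[n] p ∈ B ×ˢ {v} := by
    intro v
    set E : Set (UnitAddCircle × ZMod N) := {p | ∃ n : ℕ, (circExt α F)^[n] p ∈ B ×ˢ {v}}
    have hUm : MeasurableSet (B ×ˢ ({v} : Set (ZMod N))) :=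
      hB.measurableSet.prod (measurableSet_singleton v)
    have hE : MeasurableSet E := by
      have : E = ⋃ n : ℕ, (circExt α F)^[n] ⁻¹' (B ×ˢ {v}) := by ext; simp [E]
      rw [this]
      exact MeasurableSet.iUnion fun n => herg.measurable.iterate n hUm
    rcases herg.ae_empty_or_univ_of_preimage_ae_le hE.nullMeasurableSet
      (LE.le.eventuallyLE fun p (hp : p ∈ circExt α F ⁻¹' E) => by
        obtain ⟨n, hn⟩ := hp
        exact ⟨n + 1, hn⟩) with h | h
    · have h0 : volume.prod (unif N) (B ×ˢ {v}) = 0 :=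
        measure_mono_null (fun p hp => (⟨0, hp⟩ : p ∈ E)) (ae_eq_empty.1 h)
      rw [Measure.prod_prod, mul_eq_zero, unif_eq_zero_iff] at h0
      rcases h0 with h0 | h0
      · exact absurd h0 (hB.measure_pos volume hB0).ne'
      · exact absurd h0 (singleton_ne_empty v)
    · exact eventuallyEq_univ.1 h
  have hx₀ : ∀ᵐ y : UnitAddCircle, ∀ v : ZMod N,
      ∃ n : ℕ, (circExt α F)^[n] (y, 0) ∈ B ×ˢ {v} := by
    refine ae_all_iff.2 fun v => ?_
    filter_upwards [Measure.ae_ae_of_ae_prod (hae v)] with y hy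
    by_contra hcon
    have := unif_eq_zero_iff.1 (ae_iff.1 hy)
    exact (this ▸ (show (0 : ZMod N) ∈ _ from hcon) : (0 : ZMod N) ∈ (∅ : Set (ZMod N)))
  obtain ⟨y, hy⟩ := hx₀.exists
  choose n hn using hy
  have hloc : ∀ᶠ t : ℝ in 𝓝[>] 0, ∀ v : ZMod N,
      (circExt α F)^[n v] (y + t, 0) ∈ B ×ˢ {v} := by
    refine eventually_all.2 fun v => ?_
    have hnv := hn v
    rw [circExt_iterate, mem_prod] at hnv
    have h1 : ∀ᶠ t : ℝ in 𝓝[>] 0, y + (t : UnitAddCircle) + n v • α ∈ B := by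
      have hc : Continuous fun t : ℝ => y + (t : UnitAddCircle) + n v • α :=
        (continuous_const.add (AddCircle.continuous_mk' (1 : ℝ))).add continuous_const
      refine ((hc.tendsto 0).mono_left nhdsWithin_le_nhds).eventually (hB.mem_nhds ?_)
      simpa using hnv.1
    have h2 : ∀ᶠ t : ℝ in 𝓝[>] 0, ∀ k ∈ Finset.range (n v),
        F (y + k • α + t) = F (y + k • α) :=
      (Finset.eventually_all _).2 fun k _ => hright _
    filter_upwards [h1, h2] with t ht1 ht2
    rw [circExt_iterate, mem_prod]
    refine ⟨ht1, ?_⟩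
    have : ∑ k ∈ Finset.range (n v), F (y + t + k • α) =
        ∑ k ∈ Finset.range (n v), F (y + k • α) :=
      Finset.sum_congr rfl fun k hk => by rw [add_right_comm, ht2 k hk]
    simpa [this] using hnv.2
  obtain ⟨δ, hδ0, hδ⟩ := mem_nhdsGT_iff_exists_Ioo_subset.1 hloc
  have hW : IsOpen ((fun t : ℝ => y + (t : UnitAddCircle)) '' Ioo 0 δ) := by
    have : (fun t : ℝ => y + (t : UnitAddCircle)) '' Ioo 0 δ =
        (y + ·) '' ((fun t : ℝ => (t : UnitAddCircle)) '' Ioo 0 δ) := by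
      rw [image_image]
    rw [this]
    exact isOpenMap_add_left y _ (QuotientAddGroup.isOpenMap_coe _ isOpen_Ioo)
  have hdense : DenseRange (fun n : ℕ => x + n • α) :=
    (Homeomorph.addLeft x).surjective.denseRange.comp
      (denseRange_zsmul_iff_nsmul.1 (AddCircle.denseRange_zsmul_iff.2 hα))
      (Homeomorph.addLeft x).continuous
  obtain ⟨m, t, ht, hmt⟩ := hdense.exists_mem_open hW ((nonempty_Ioo.2 hδ0).image _)
  dsimp only at hmt
  set v := s + ∑ k ∈ Finset.range m, F (x + k • α) with hv
  refine ⟨n (u - v) + m, ?_⟩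
  have h3 := hδ ht (u - v)
  rw [circExt_iterate, hmt, mem_prod] at h3
  rw [Function.iterate_add_apply, circExt_iterate, circExt_iterate, ← hv, mem_prod]
  refine ⟨h3.1, ?_⟩
  have h4 := h3.2
  simp only [zero_add, mem_singleton_iff] at h4
  simp [h4]

lemma UniquelyErgodic.of_semiconj {X Y : Type*} [MeasurableSpace X] [MeasurableSpace Y]
    (Φ : X ≃ᵐ Y) {G : X → X} {H : Y → Y} (h : Function.Semiconj Φ G H) (hH : UniquelyErgodic H) :
    UniquelyErgodic G := by
  have hG : G = Φ.symm ∘ H ∘ Φ := by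
    ext x
    simp [← h.eq]
  have hH' : H = Φ ∘ G ∘ Φ.symm := by
    ext y
    simp [h.eq]
  obtain ⟨ν, ⟨hν, hνH⟩, huniq⟩ := hH
  have hsymm : MeasurePreserving Φ.symm ν (ν.map Φ.symm) := Φ.symm.measurable.measurePreserving ν
  refine ⟨ν.map Φ.symm, ⟨Measure.isProbabilityMeasure_map Φ.symm.measurable.aemeasurable, ?_⟩, ?_⟩
  · rw [hG]
    exact hsymm.comp (hνH.comp (MeasurePreserving.symm Φ.symm hsymm))
  · rintro μ ⟨hμ, hμG⟩
    have hΦ : MeasurePreserving Φ μ (μ.map Φ) := Φ.measurable.measurePreserving μ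
    have := huniq (μ.map Φ) ⟨Measure.isProbabilityMeasure_map Φ.measurable.aemeasurable, by
      rw [hH']
      exact hΦ.comp (hμG.comp (MeasurePreserving.symm Φ hΦ))⟩
    rw [← this, MeasurableEquiv.map_symm_map]

/-- The quotient map from `[0,1)` to the circle, as a measurable equivalence. -/
def icoEquivCircle : Ico (0 : ℝ) 1 ≃ᵐ UnitAddCircle where
  toFun x := ((x : ℝ) : UnitAddCircle)
  invFun y := ⟨AddCircle.measurableEquivIco 1 0 y, by
    simpa using (AddCircle.measurableEquivIco 1 0 y).2⟩
  left_inv x := by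
    refine Subtype.ext ?_
    change ((AddCircle.equivIco (1 : ℝ) 0 ((x : ℝ) : UnitAddCircle) : ℝ)) = x
    rw [AddCircle.coe_equivIco_mk_apply, div_one, mul_one, Int.fract_eq_self.2 x.2]
  right_inv y := (AddCircle.equivIco (1 : ℝ) 0).symm_apply_apply y
  measurable_toFun := AddCircle.measurable_mk'.comp measurable_subtype_coe
  measurable_invFun := by
    refine Measurable.subtype_mk ?_
    exact measurable_subtype_coe.comp (AddCircle.measurableEquivIco 1 0).measurable

lemma icoEquivCircle_symm_coe {x : ℝ} (hx : x ∈ Ico (0 : ℝ) 1) :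
    (icoEquivCircle.symm (x : UnitAddCircle) : ℝ) = x :=
  congrArg Subtype.val (icoEquivCircle.symm_apply_apply ⟨x, hx⟩)

lemma coe_mem_arc_iff {r t : ℝ} (hr : r ∈ Ico (0 : ℝ) 1) (ht : t ≤ 1) :
    (r : UnitAddCircle) ∈ arc t ↔ r < t := by
  constructor
  · rintro ⟨b, hb, hbr⟩
    have : b = r := (AddCircle.coe_eq_coe_iff_of_mem_Ico (a := (0 : ℝ)) (p := (1 : ℝ))
      ⟨hb.1, by linarith [hb.2]⟩ ⟨hr.1, by linarith [hr.2]⟩).1 hbr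
    exact this ▸ hb.2
  · exact fun h => ⟨r, ⟨hr.1, h⟩, rfl⟩

/-- Membership of `y - Z` in the arc `[0, t)`, for representatives `y, Z ∈ [0,1)`. -/
lemma coe_sub_mem_arc_iff {y Z t : ℝ} (hy : y ∈ Ico (0 : ℝ) 1) (hZ : Z ∈ Ico (0 : ℝ) 1)
    (ht : t ≤ 1) : ((y : UnitAddCircle) - (Z : UnitAddCircle)) ∈ arc t ↔
      (Z ≤ y ∧ y - Z < t) ∨ (y < Z ∧ y - Z + 1 < t) := by
  have h1 := hy.1
  have h2 := hy.2
  have h3 := hZ.1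
  have h4 := hZ.2
  rw [← AddCircle.coe_sub]
  rcases le_or_gt Z y with h | h
  · rw [coe_mem_arc_iff ⟨by linarith, by linarith⟩ ht]
    simp [h, not_lt.2 h]
  · rw [← AddCircle.coe_add_period, coe_mem_arc_iff ⟨by linarith, by linarith⟩ ht]
    simp [h, not_le.2 h]

lemma sum_ite_le_sub {G : Type*} [AddCommGroup G] {q : ℕ} (g : Fin (q + 1) → G)
    (k : Fin (q + 1)) :
    ∑ i, (if i ≤ k then g i - g (i - 1) else 0) = g k - g (Fin.last q) := by
  induction k using Fin.induction with
  | zero =>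
    rw [Finset.sum_eq_single 0]
    · have : (0 : Fin (q + 1)) - 1 = Fin.last q := by
        rw [zero_sub]
        exact Fin.ext Fin.coe_neg_one
      simp [this]
    · intro b _ hb
      rw [if_neg]
      rwa [Fin.le_zero_iff]
    · simp
  | succ k ih =>
    have hk : k.succ - 1 = k.castSucc := by
      rw [sub_eq_iff_eq_add, Fin.coeSucc_eq_succ]
    have h1 : ∀ i, (if i ≤ k.succ then g i - g (i - 1) else 0) =
        (if i ≤ k.castSucc then g i - g (i - 1) else 0) +
          if i = k.succ then g i - g (i - 1) else 0 := by
      intro i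
      have hle : i ≤ k.succ ↔ i ≤ k.castSucc ∨ i = k.succ := by
        simp only [Fin.le_def, Fin.ext_iff, Fin.val_succ, Fin.val_castSucc]
        omega
      have hne : ¬ (k.succ ≤ k.castSucc) := by simp
      by_cases hi : i = k.succ
      · subst hi
        simp
      · simp [hle, hi]
    simp_rw [h1]
    rw [Finset.sum_add_distrib, ih, Finset.sum_ite_eq' Finset.univ k.succ, hk]
    simp

lemma le_zIdx_iff {q : ℕ} {ζ : Fin q → ℝ} (hζ : StrictMono ζ) {y : ℝ} (hy : 0 ≤ y)
    (i : Fin (q + 1)) : i ≤ zIdx q ζ y ↔ (Fin.cons (0 : ℝ) ζ : Fin (q + 1) → ℝ) i ≤ y := by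
  refine Fin.cases (by simp [hy]) (fun j => ?_) i
  rw [Fin.cons_succ, Fin.le_def, Fin.val_succ]
  change (j : ℕ) + 1 ≤ (Finset.univ.filter fun i => ζ i ≤ y).card ↔ _
  constructor
  · intro h
    by_contra! hlt
    have hsub : (Finset.univ.filter fun i => ζ i ≤ y) ⊆ Finset.Iio j := by
      intro i hi
      rw [Finset.mem_filter] at hi
      exact Finset.mem_Iio.2 (hζ.lt_iff_lt.1 (hi.2.trans_lt hlt))
    have := Finset.card_le_card hsub
    rw [Fin.card_Iio] at this
    omega
  · intro h
    have hsub : Finset.Iic j ⊆ Finset.univ.filter fun i => ζ i ≤ y := by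
      intro i hi
      exact Finset.mem_filter.2
        ⟨Finset.mem_univ i, (hζ.monotone (Finset.mem_Iic.1 hi)).trans h⟩
    have := Finset.card_le_card hsub
    rwa [Fin.card_Iic] at this

lemma stepFun_eq_sum (N : ℕ) {q : ℕ} {ζ : Fin q → ℝ} (hζ : StrictMono ζ) (a : Fin (q + 1) → ℤ)
    {y : ℝ} (hy : 0 ≤ y) :
    stepFun N q ζ a y = a (Fin.last q) +
      ∑ i, if (Fin.cons (0 : ℝ) ζ : Fin (q + 1) → ℝ) i ≤ y
        then ((a i - a (i - 1) : ℤ) : ZMod N) else 0 := by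
  have := sum_ite_le_sub (fun i => (a i : ZMod N)) (zIdx q ζ y)
  simp_rw [le_zIdx_iff hζ hy] at this
  push_cast
  rw [this, stepFun]
  ring

/-- The step function, as a function on the circle. -/
def circStep (N q : ℕ) (ζ : Fin q → ℝ) (a : Fin (q + 1) → ℤ) (y : UnitAddCircle) : ZMod N :=
  stepFun N q ζ a (icoEquivCircle.symm y)

lemma circStep_coe {N q : ℕ} {ζ : Fin q → ℝ} {a : Fin (q + 1) → ℤ} {x : ℝ}
    (hx : x ∈ Ico (0 : ℝ) 1) : circStep N q ζ a x = stepFun N q ζ a x := by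
  rw [circStep, icoEquivCircle_symm_coe hx]

lemma measurable_circStep {N q : ℕ} [NeZero N] {ζ : Fin q → ℝ} (hζ : StrictMono ζ)
    (a : Fin (q + 1) → ℤ) : Measurable (circStep N q ζ a) := by
  have h : circStep N q ζ a = fun y => (a (Fin.last q) : ZMod N) +
      ∑ i, if (Fin.cons (0 : ℝ) ζ : Fin (q + 1) → ℝ) i ≤ icoEquivCircle.symm y
        then ((a i - a (i - 1) : ℤ) : ZMod N) else 0 :=
    funext fun y => stepFun_eq_sum N hζ a (icoEquivCircle.symm y).2.1
  rw [h]
  refine measurable_const.add (Finset.measurable_sum _ fun i _ => Measurable.ite ?_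
    measurable_const measurable_const)
  exact measurableSet_le measurable_const
    (measurable_subtype_coe.comp icoEquivCircle.symm.measurable)

open Classical in
lemma circStep_add_sub {N q : ℕ} {ζ : Fin q → ℝ} (hζ : StrictMono ζ)
    (hζmem : ∀ i, ζ i ∈ Ioo (0 : ℝ) 1) (a : Fin (q + 1) → ℤ) (x : UnitAddCircle)
    {t : ℝ} (ht : t ∈ Ioo (0 : ℝ) 1) :
    circStep N q ζ a (x + t) - circStep N q ζ a x =
      ∑ i, if x + t - ((Fin.cons (0 : ℝ) ζ : Fin (q + 1) → ℝ) i : UnitAddCircle) ∈ arc t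
        then ((a i - a (i - 1) : ℤ) : ZMod N) else 0 := by
  obtain ⟨⟨b, hb⟩, rfl⟩ := icoEquivCircle.surjective x
  change circStep N q ζ a ((b : UnitAddCircle) + t) - circStep N q ζ a (b : UnitAddCircle) =
    ∑ i, if (b : UnitAddCircle) + t - _ ∈ arc t then _ else _
  have hZ : ∀ i, (Fin.cons (0 : ℝ) ζ : Fin (q + 1) → ℝ) i ∈ Ico (0 : ℝ) 1 := by
    refine Fin.cases (by simp) fun j => ?_
    rw [Fin.cons_succ]
    exact ⟨(hζmem j).1.le, (hζmem j).2⟩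
  have hb1 := hb.1
  have hb2 := hb.2
  have ht1 := ht.1
  have ht2 := ht.2
  rcases lt_or_ge (b + t) 1 with h | h
  · have hy : b + t ∈ Ico (0 : ℝ) 1 := ⟨by linarith, h⟩
    rw [← AddCircle.coe_add, circStep_coe hy, circStep_coe hb, stepFun_eq_sum N hζ a hy.1,
      stepFun_eq_sum N hζ a hb.1, add_sub_add_left_eq_sub, ← Finset.sum_sub_distrib]
    refine Finset.sum_congr rfl fun i _ => ?_
    rw [coe_sub_mem_arc_iff hy (hZ i) ht2.le]
    have hZ1 := (hZ i).1
    have hZ2 := (hZ i).2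
    generalize (Fin.cons (0 : ℝ) ζ : Fin (q + 1) → ℝ) i = Z at hZ1 hZ2 ⊢
    split_ifs <;> first | (simp; done) | (exfalso; grind)
  · have hy : b + t - 1 ∈ Ico (0 : ℝ) 1 := ⟨by linarith, by linarith⟩
    have hcoe : (b : UnitAddCircle) + t = ((b + t - 1 : ℝ) : UnitAddCircle) := by
      rw [← AddCircle.coe_add, ← AddCircle.coe_add_period 1 (b + t - 1), sub_add_cancel]
    have hsum : ∑ i, ((a i - a (i - 1) : ℤ) : ZMod N) = 0 := by
      have := sum_ite_le_sub (fun i => (a i : ZMod N)) (Fin.last q)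
      simpa [Fin.le_last] using this
    rw [hcoe, circStep_coe hy, circStep_coe hb, stepFun_eq_sum N hζ a hy.1,
      stepFun_eq_sum N hζ a hb.1, add_sub_add_left_eq_sub, ← Finset.sum_sub_distrib]
    refine ((add_zero _).symm.trans (congrArg (_ + ·) hsum.symm)).trans ?_
    rw [← Finset.sum_add_distrib]
    refine Finset.sum_congr rfl fun i _ => ?_
    rw [coe_sub_mem_arc_iff hy (hZ i) ht2.le]
    have hZ1 := (hZ i).1
    have hZ2 := (hZ i).2
    generalize (Fin.cons (0 : ℝ) ζ : Fin (q + 1) → ℝ) i = Z at hZ1 hZ2 ⊢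
    split_ifs <;> first | (simp; done) | (exfalso; grind)

open Classical in
/-- A function on the circle whose increments come from jumps at finitely many points is locally
constant on the right. -/
lemma eventually_eq_of_jumps {ι G : Type*} [Fintype ι] [AddCommGroup G] {F : UnitAddCircle → G}
    {z : ι → UnitAddCircle} {e : ι → G}
    (hF : ∀ x, ∀ t ∈ Ioo (0 : ℝ) 1, F (x + t) - F x =
      ∑ i, if x + t - z i ∈ arc t then e i else 0) (x : UnitAddCircle) :
    ∀ᶠ t : ℝ in 𝓝[>] 0, F (x + t) = F x := by
  have key : ∀ i, ∀ᶠ t : ℝ in 𝓝[>] 0, x + t - z i ∉ arc t := by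
    intro i
    obtain ⟨⟨b, hb⟩, hbx⟩ := icoEquivCircle.surjective (x - z i)
    have hbx' : (b : UnitAddCircle) = x - z i := hbx
    filter_upwards [Ioo_mem_nhdsGT (show (0 : ℝ) < 1 - b by linarith [hb.2])] with t ht
    have : x + t - z i = ((b + t : ℝ) : UnitAddCircle) := by
      rw [AddCircle.coe_add, hbx']
      abel
    rw [this, coe_mem_arc_iff ⟨by linarith [hb.1, ht.1], by linarith [ht.2]⟩
      (by linarith [hb.1, ht.2])]
    linarith [hb.1]
  filter_upwards [eventually_all.2 key, Ioo_mem_nhdsGT (zero_lt_one' ℝ)] with t ht ht1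
  rw [← sub_eq_zero, hF x t ht1]
  exact Finset.sum_eq_zero fun i _ => if_neg (ht i)

lemma skew_iterate_eq_circExt_iterate {N q : ℕ} {α : ℝ} {ζ : Fin q → ℝ} {a : Fin (q + 1) → ℤ}
    {x : ℝ} (hx : x ∈ Ico (0 : ℝ) 1) (s : ZMod N) (n : ℕ) :
    ((skew (rot α) (stepFun N q ζ a))^[n] (x, s)).1 ∈ Ico (0 : ℝ) 1 ∧
      (circExt (α : UnitAddCircle) (circStep N q ζ a))^[n] ((x : UnitAddCircle), s) =
        ((((skew (rot α) (stepFun N q ζ a))^[n] (x, s)).1 : UnitAddCircle),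
          ((skew (rot α) (stepFun N q ζ a))^[n] (x, s)).2) := by
  induction n with
  | zero => exact ⟨hx, rfl⟩
  | succ n ih =>
    rw [Function.iterate_succ_apply', Function.iterate_succ_apply', ih.2]
    generalize (skew (rot α) (stepFun N q ζ a))^[n] (x, s) = p at ih ⊢
    refine ⟨⟨Int.fract_nonneg _, Int.fract_lt_one _⟩, ?_⟩
    simp only [circExt, skew, rot, circStep_coe ih.1, AddCircle.coe_fract, AddCircle.coe_add]

lemma isUnit_of_forall_mul_ne_zero {R : Type*} [CommRing R] [Finite R] {u : R}
    (h : ∀ d : R, d ≠ 0 → d * u ≠ 0) : IsUnit u := by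
  refine isUnit_iff_mem_nonZeroDivisors_of_finite.2 (mem_nonZeroDivisors_iff_right.2 ?_)
  intro d hd
  by_contra hd0
  exact h d hd0 hd

/-- Merrill's criterion: let `α` be badly approximable, and `T_f` the extension of the
rotation by `α` given by marked points `ζ₁ < ... < ζ_q` and integers `a₁, ..., a_{q+1}`.
If some difference `ζ_i - ζ_j` (with `ζ₀ = 0`) is not in `ℤ + αℤ`, and for every `d ≠ 0`
in `ℤ/Nℤ` no nonempty proper subfamily of the jumps `d·e₀, ..., d·e_q` (where
`e i = a i - a (i-1)` cyclically) has sum `0`, then `T_f` is minimal and uniquely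
ergodic. -/
theorem merrill_minimal_and_uniquelyErgodic
    (α : ℝ) (hα : α ∈ Ioo (0:ℝ) 1) (hirr : Irrational α)
    (hbad : ∃ c > 0, ∀ p q : ℤ, 1 ≤ q → c / q ≤ |q * α - p|)
    (N : ℕ) (hN : 2 ≤ N) (q : ℕ)
    (ζ : Fin q → ℝ) (hζmono : StrictMono ζ) (hζmem : ∀ i, ζ i ∈ Ioo (0:ℝ) 1)
    (a : Fin (q + 1) → ℤ)
    (hdist : ∃ i j : Fin (q + 1), j < i ∧
      ¬ ∃ m n : ℤ, (Fin.cons (0:ℝ) ζ : Fin (q+1) → ℝ) i - (Fin.cons (0:ℝ) ζ : Fin (q+1) → ℝ) j = (m : ℝ) * α + n)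
    (hsum : ∀ d : ZMod N, d ≠ 0 → ∀ s : Finset (Fin (q + 1)),
      s.Nonempty → s ≠ Finset.univ →
      ∑ i ∈ s, d * ((a i - a (i - 1) : ℤ) : ZMod N) ≠ 0) :
    MinimalExt (rot α) (stepFun N q ζ a) ∧
      UniquelyErgodic (rotExt N α (stepFun N q ζ a)) := by
  have : NeZero N := ⟨by omega⟩
  obtain ⟨c, hc, hbad⟩ := hbad
  have hbad' : ∀ n : ℕ, 1 ≤ n → c / n ≤ ‖n • (α : UnitAddCircle)‖ := by
    intro n hn
    rw [← AddCircle.coe_nsmul, UnitAddCircle.norm_eq]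
    simpa using hbad (round (n • α)) n (by exact_mod_cast hn)
  have hord : addOrderOf (α : UnitAddCircle) = 0 := by
    refine addOrderOf_eq_zero_iff'.2 fun n hn h0 => ?_
    have h1 := hbad' n hn
    rw [h0, norm_zero] at h1
    have : 0 < c / n := by positivity
    linarith
  have hF := fun x t ht => circStep_add_sub (N := N) hζmono hζmem a x (t := t) ht
  have hunit : ∀ s : Finset (Fin (q + 1)), s.Nonempty → s ≠ Finset.univ →
      IsUnit (∑ i ∈ s, ((a i - a (i - 1) : ℤ) : ZMod N)) := by
    intro s hs hs'
    refine isUnit_of_forall_mul_ne_zero fun d hd => ?_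
    rw [Finset.mul_sum]
    exact hsum d hd s hs hs'
  have hz : ∃ i j, (((Fin.cons (0 : ℝ) ζ : Fin (q + 1) → ℝ) i : ℝ) : UnitAddCircle) -
      ((Fin.cons (0 : ℝ) ζ : Fin (q + 1) → ℝ) j : ℝ) ∉
        AddSubgroup.zmultiples (α : UnitAddCircle) := by
    obtain ⟨i, j, -, hij⟩ := hdist
    refine ⟨i, j, ?_⟩
    rintro ⟨m, hm⟩
    refine hij ⟨m, ?_⟩
    dsimp only at hm
    rw [← AddCircle.coe_sub, ← AddCircle.coe_zsmul, eq_comm, ← sub_eq_zero, ← AddCircle.coe_sub,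
      AddCircle.coe_eq_zero_iff] at hm
    obtain ⟨n, hn⟩ := hm
    refine ⟨n, ?_⟩
    simp only [zsmul_eq_mul, mul_one] at hn
    linarith
  have herg := ergodic_circExt hc hbad' (measurable_circStep hζmono a) hF hunit hz hord
  constructor
  · intro x hx s y _ u ε hε
    obtain ⟨n, hn⟩ := exists_iterate_mem_of_ergodic hord herg (eventually_eq_of_jumps hF) x s
      (Metric.isOpen_ball (x := (y : UnitAddCircle)) (ε := ε)) (Metric.nonempty_ball.2 hε) u
    rw [(skew_iterate_eq_circExt_iterate hx s n).2] at hn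
    exact ⟨n, hn.1, hn.2⟩
  · refine UniquelyErgodic.of_semiconj (icoEquivCircle.prodCongr (MeasurableEquiv.refl _)) ?_
      (uniquelyErgodic_circExt hord herg)
    rintro ⟨x, s⟩
    refine Prod.ext ?_ ?_
    · change ((Int.fract ((x : ℝ) + α) : ℝ) : UnitAddCircle) = (x : ℝ) + (α : ℝ)
      rw [AddCircle.coe_fract, AddCircle.coe_add]
    · change s + stepFun N q ζ a x = s + circStep N q ζ a ((x : ℝ) : UnitAddCircle)
      rw [circStep_coe x.2]
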